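/- arXiv:quant-ph/0009039 — 8 statements merged into one kernel-verified Lean document; each statement's English description precedes it below -/
import Mathlib

section
/- Let S be a fixed set of permissible block sizes and L a fixed set of permissible loop lengths, and let 𝒞 be the class of all diagrams (optionally restricted to connected diagrams) in which every block has its size in S and every loop has its order in L. Then the only irreducible diagrams in 𝒞 are those with exactly one block; that is, for every D ∈ 𝒞 with more than one block there exists a block e of D such that D−e ∈ 𝒞. -/
/-- A (pre-)diagram: a finite set `V` of atoms and a set `E` of blocks
(finite sets of atoms). -/
structure PreDiagram (α : Type*) where
  V : Finset α
  E : Finset (Finset α)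

namespace PreDiagram

variable {α : Type*} [DecidableEq α]

/-- `D` is a diagram: `V` is nonempty and every block is a nonempty subset of `V`. -/
def IsDiagram (D : PreDiagram α) : Prop :=
  D.V.Nonempty ∧ ∀ e ∈ D.E, e.Nonempty ∧ e ⊆ D.V

/-- `f` is an isomorphism from `D₁` to `D₂`: it is a bijection from `V₁` to `V₂`
and the induced image map is a bijection from `E₁` to `E₂`. -/
def IsIso (D₁ D₂ : PreDiagram α) (f : α → α) : Prop :=
  Set.BijOn f ↑D₁.V ↑D₂.V ∧
    (∀ e ∈ D₁.E, e.image f ∈ D₂.E) ∧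
    (∀ e' ∈ D₂.E, ∃ e ∈ D₁.E, e.image f = e')

/-- Two diagrams are isomorphic if there is an isomorphism between them. -/
def Isomorphic (D₁ D₂ : PreDiagram α) : Prop :=
  ∃ f : α → α, IsIso D₁ D₂ f

/-- `D + e`: add the block `e` (and its atoms) to `D`. -/
def addBlock (D : PreDiagram α) (e : Finset α) : PreDiagram α :=
  ⟨D.V ∪ e, insert e D.E⟩

/-- `D − e`: remove the block `e` and any atoms that were in `e` but in no
other block. -/
def removeBlock (D : PreDiagram α) (e : Finset α) : PreDiagram α :=
  ⟨D.V.filter fun v => v ∉ e ∨ ∃ e' ∈ D.E.erase e, v ∈ e', D.E.erase e⟩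

/-- The rank of an atom: the number of blocks containing it. -/
def rank (D : PreDiagram α) (v : α) : ℕ :=
  (D.E.filter fun e => v ∈ e).card

/-- A diagram is connected if every two atoms are joined by a chain of
pairwise-intersecting blocks. -/
def Connected (D : PreDiagram α) : Prop :=
  ∀ v ∈ D.V, ∀ v' ∈ D.V, ∃ (k : ℕ) (c : ℕ → Finset α),
    (∀ i ≤ k, c i ∈ D.E) ∧ v ∈ c 0 ∧ v' ∈ c k ∧
    ∀ i < k, ((c i) ∩ (c (i + 1))).Nonempty

/-- `D` has a loop of order `n ≥ 2`: `n` mutually distinct blocks `e 0, …, e (n-1)`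
together with mutually distinct atoms `v i ∈ e i ∩ e (i+1)` (cyclically). -/
def HasLoop (D : PreDiagram α) (n : ℕ) : Prop :=
  2 ≤ n ∧ ∃ (e : ℕ → Finset α) (v : ℕ → α),
    (∀ i < n, e i ∈ D.E) ∧
    (∀ i < n, ∀ j < n, e i = e j → i = j) ∧
    (∀ i < n, ∀ j < n, v i = v j → i = j) ∧
    (∀ i < n, v i ∈ e i ∧ v i ∈ e ((i + 1) % n))

/-- `D` is reducible relative to the class `C`: it has more than one block and
some block can be removed staying inside `C`. -/
def Reducible (C : Set (PreDiagram α)) (D : PreDiagram α) : Prop :=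
  1 < D.E.card ∧ ∃ e ∈ D.E, removeBlock D e ∈ C

/-- `O` is an orbit of blocks of `D` under the action of `Aut D`. -/
def IsBlockOrbit (D : PreDiagram α) (O : Set (Finset α)) : Prop :=
  O.Nonempty ∧ O ⊆ ↑D.E ∧
    ∀ e ∈ O, ∀ e' : Finset α, e' ∈ O ↔ ∃ f : α → α, IsIso D D f ∧ e.image f = e'

end PreDiagram

open PreDiagram

/-- the intersection graph on the blocks -/
def PreDiagram.blockGraph {α : Type*} [DecidableEq α] (D : PreDiagram α) :
    SimpleGraph {e // e ∈ D.E} where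
  Adj a b := a ≠ b ∧ (a.1 ∩ b.1).Nonempty
  symm := ⟨fun a b h => ⟨h.1.symm, by rw [Finset.inter_comm]; exact h.2⟩⟩
  loopless := ⟨fun a h => h.1 rfl⟩

theorem PreDiagram.reach_of_inter {α : Type*} [DecidableEq α] (D : PreDiagram α)
    (a b : {e // e ∈ D.E}) (h : (a.1 ∩ b.1).Nonempty) : D.blockGraph.Reachable a b := by
  by_cases hab : a = b
  · subst hab; exact SimpleGraph.Reachable.refl _
  · exact SimpleGraph.Adj.reachable (G := D.blockGraph) ⟨hab, h⟩

theorem PreDiagram.exists_removable {α : Type*} [DecidableEq α] (D : PreDiagram α)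
    (hD : IsDiagram D) (hc : Connected D) (hcard : 1 < D.E.card) :
    ∃ e ∈ D.E, Connected (D.removeBlock e) := by
  have hpre : D.blockGraph.Preconnected := by
    intro a b
    obtain ⟨x, hx⟩ := (hD.2 a.1 a.2).1
    obtain ⟨y, hy⟩ := (hD.2 b.1 b.2).1
    obtain ⟨k, c, hcE, hx0, hyk, hi⟩ :=
      hc x ((hD.2 a.1 a.2).2 hx) y ((hD.2 b.1 b.2).2 hy)
    have key : ∀ i, ∀ h : i ≤ k, D.blockGraph.Reachable a ⟨c i, hcE i h⟩ := by
      intro i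
      induction i with
      | zero =>
        intro h
        exact D.reach_of_inter _ _ ⟨x, Finset.mem_inter.2 ⟨hx, hx0⟩⟩
      | succ i ih =>
        intro h
        exact (ih (by omega)).trans (D.reach_of_inter _ _ (hi i (by omega)))
    exact (key k le_rfl).trans (D.reach_of_inter _ _ ⟨y, Finset.mem_inter.2 ⟨hyk, hy⟩⟩)
  haveI : Nontrivial {e // e ∈ D.E} := by
    obtain ⟨a, ha, b, hb, hab⟩ := Finset.one_lt_card.1 hcard
    exact ⟨⟨a, ha⟩, ⟨b, hb⟩, fun h => hab (congrArg Subtype.val h)⟩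
  have hconn : D.blockGraph.Connected := (SimpleGraph.connected_iff _).2 ⟨hpre, inferInstance⟩
  obtain ⟨e, he⟩ := hconn.exists_connected_induce_compl_singleton_of_finite_nontrivial
  refine ⟨e.1, e.2, ?_⟩
  have hcov : ∀ v ∈ (D.removeBlock e.1).V, ∃ f : {e // e ∈ D.E}, f ≠ e ∧ v ∈ f.1 := by
    intro v hv
    obtain ⟨hvV, h⟩ := Finset.mem_filter.1 hv
    rcases h with h | ⟨f, hf, hvf⟩
    · obtain ⟨k, c, hcE, hx0, -, -⟩ := hc v hvV v hvV
      refine ⟨⟨c 0, hcE 0 (Nat.zero_le _)⟩, ?_, hx0⟩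
      rintro rfl
      exact h hx0
    · obtain ⟨hne, hfE⟩ := Finset.mem_erase.1 hf
      exact ⟨⟨f, hfE⟩, fun h => hne (congrArg Subtype.val h), hvf⟩
  intro v hv w hw
  obtain ⟨a, hae, hva⟩ := hcov v hv
  obtain ⟨b, hbe, hwb⟩ := hcov w hw
  obtain ⟨p⟩ := he.preconnected ⟨a, hae⟩ ⟨b, hbe⟩
  refine ⟨p.length, fun i => (p.getVert i).1.1, ?_, ?_, ?_, ?_⟩
  · intro i _
    exact Finset.mem_erase.2 ⟨fun h => (p.getVert i).2 (Subtype.ext h), (p.getVert i).1.2⟩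
  · simpa using hva
  · simpa using hwb
  · intro i hi
    have h := p.adj_getVert_succ hi
    exact h.2

theorem PreDiagram.removeBlock_isDiagram {α : Type*} [DecidableEq α] (D : PreDiagram α)
    (hD : IsDiagram D) (hcard : 1 < D.E.card) (e : Finset α) :
    IsDiagram (D.removeBlock e) := by
  have hsub : ∀ f ∈ (D.removeBlock e).E, f.Nonempty ∧ f ⊆ (D.removeBlock e).V := by
    intro f hf
    have hfE := Finset.mem_of_mem_erase hf
    exact ⟨(hD.2 f hfE).1, fun x hx =>
      Finset.mem_filter.2 ⟨(hD.2 f hfE).2 hx, Or.inr ⟨f, hf, hx⟩⟩⟩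
  refine ⟨?_, hsub⟩
  obtain ⟨f, hf, hfe⟩ := Finset.exists_mem_ne hcard e
  obtain ⟨h1, h2⟩ := hsub f (Finset.mem_erase.2 ⟨hfe, hf⟩)
  exact h1.mono h2

/-- let `C` be the class of all diagrams (optionally restricted to
connected diagrams) whose block sizes all lie in `S` and whose loop orders all
lie in `L`.  Then every `D ∈ C` with more than one block has a block `e` with
`D − e ∈ C`; i.e. the only irreducible diagrams in `C` are the one-block ones. -/
theorem irreducible_iff_one_block {α : Type*} [DecidableEq α]
    (S L : Set ℕ) (conn : Bool) (C : Set (PreDiagram α))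
    (hC : ∀ D : PreDiagram α, D ∈ C ↔
      IsDiagram D ∧ (∀ e ∈ D.E, e.card ∈ S) ∧
      (∀ n : ℕ, HasLoop D n → n ∈ L) ∧ (conn = true → Connected D))
    (D : PreDiagram α) (hD : D ∈ C) (hcard : 1 < D.E.card) :
    ∃ e ∈ D.E, D.removeBlock e ∈ C := by
  obtain ⟨hd, hS, hL, hconn⟩ := (hC D).1 hD
  have main : ∃ e ∈ D.E, (conn = true → Connected (D.removeBlock e)) := by
    by_cases h : conn = true
    · obtain ⟨e, he, hc⟩ := D.exists_removable hd (hconn h) hcard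
      exact ⟨e, he, fun _ => hc⟩
    · obtain ⟨e, he⟩ := Finset.card_pos.1 (by omega : 0 < D.E.card)
      exact ⟨e, he, fun h' => absurd h' h⟩
  obtain ⟨e, he, hc⟩ := main
  refine ⟨e, he, (hC _).2 ⟨D.removeBlock_isDiagram hd hcard e, ?_, ?_, hc⟩⟩
  · exact fun f hf => hS f (Finset.mem_of_mem_erase hf)
  · rintro n ⟨hn, b, v, hb, h⟩
    exact hL n ⟨hn, b, v, fun i hi => Finset.mem_of_mem_erase (hb i hi), h⟩
end

section
/- Let D = (V,E) be a diagram with α atoms and β blocks in which every block has exactly 3 atoms and every atom has rank at least 2. If 6α > 7β, then some block of D contains at least two distinct atoms of rank 2. -/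
open PreDiagram

/-- a diagram with `α` atoms and `β` blocks, all blocks of size 3,
all atoms of rank at least 2, and `6α > 7β`, has a block containing at least
two distinct atoms of rank 2. -/
theorem exists_block_with_two_rank_two_atoms {α : Type*} [DecidableEq α]
    (D : PreDiagram α) (hD : IsDiagram D)
    (h3 : ∀ e ∈ D.E, e.card = 3)
    (hr : ∀ v ∈ D.V, 2 ≤ D.rank v)
    (hcount : 7 * D.E.card < 6 * D.V.card) :
    ∃ e ∈ D.E, ∃ x ∈ e, ∃ y ∈ e, x ≠ y ∧ D.rank x = 2 ∧ D.rank y = 2 := by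
  by_contra hcon
  have dc : ∀ T : Finset α, ∑ v ∈ T, D.rank v = ∑ e ∈ D.E, (T.filter fun v => v ∈ e).card := by
    intro T
    exact Finset.sum_card_bipartiteAbove_eq_sum_card_bipartiteBelow (fun v e => v ∈ e)
  have h1 : ∑ v ∈ D.V, D.rank v ≤ D.E.card * 3 := by
    rw [dc]
    refine Finset.sum_le_card_nsmul _ _ _ fun e he => ?_
    rw [← h3 e he]
    exact Finset.card_le_card fun v hv => (Finset.mem_filter.1 hv).2
  have h2 : ∑ v ∈ D.V.filter (fun v => D.rank v = 2), D.rank v ≤ D.E.card * 1 := by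
    rw [dc]
    refine Finset.sum_le_card_nsmul _ _ _ fun e he => ?_
    refine Finset.card_le_one.2 fun x hx y hy => ?_
    simp only [Finset.mem_filter] at hx hy
    by_contra hne
    exact hcon ⟨e, he, x, hx.2, y, hy.2, hne, hx.1.2, hy.1.2⟩
  have h4 : ∑ v ∈ D.V.filter (fun v => D.rank v = 2), D.rank v
      = (D.V.filter (fun v => D.rank v = 2)).card * 2 :=
    Finset.sum_const_nat fun v hv => (Finset.mem_filter.1 hv).2
  have h5 : (D.V.filter (fun v => ¬ D.rank v = 2)).card * 3
      ≤ ∑ v ∈ D.V.filter (fun v => ¬ D.rank v = 2), D.rank v := by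
    rw [← smul_eq_mul]
    refine Finset.card_nsmul_le_sum _ D.rank 3 fun v hv => ?_
    have h := Finset.mem_filter.1 hv
    have := hr v h.1
    have := h.2
    omega
  have h6 := Finset.sum_filter_add_sum_filter_not D.V (fun v => D.rank v = 2) D.rank
  have h7 := Finset.card_filter_add_card_filter_not (s := D.V) (fun v => D.rank v = 2)
  omega
end

section
/- Let D = (V,E) be a diagram with α atoms and β blocks in which every block has exactly 3 atoms, every atom has rank at least 2, and no block contains two distinct atoms of rank 2. If 14α > 15β, then there exists an atom y of rank 3 and two distinct blocks, each containing y, such that each of the two blocks also contains an atom of rank 2. -/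
open PreDiagram

/-- in a diagram with `α` atoms and `β` blocks, all blocks of
size 3, all atoms of rank at least 2, no block containing two distinct atoms of
rank 2, and `14α > 15β`, there is an atom `y` of rank 3 lying in two distinct
blocks each of which contains an atom of rank 2. -/
theorem exists_rank_three_atom_in_two_blocks {α : Type*} [DecidableEq α]
    (D : PreDiagram α) (hD : IsDiagram D)
    (h3 : ∀ e ∈ D.E, e.card = 3)
    (hr : ∀ v ∈ D.V, 2 ≤ D.rank v)
    (hno2 : ∀ e ∈ D.E, ∀ x ∈ e, ∀ y ∈ e, D.rank x = 2 → D.rank y = 2 → x = y)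
    (hcount : 15 * D.E.card < 14 * D.V.card) :
    ∃ y ∈ D.V, D.rank y = 3 ∧
      ∃ e₁ ∈ D.E, ∃ e₂ ∈ D.E, e₁ ≠ e₂ ∧ y ∈ e₁ ∧ y ∈ e₂ ∧
        (∃ x ∈ e₁, D.rank x = 2) ∧ ∃ x ∈ e₂, D.rank x = 2 := by
  classical
  by_contra hcon
  let T : Finset (Finset α) := D.E.filter fun e => ∃ x ∈ e, D.rank x = 2
  let t : α → ℕ := fun v => (T.filter fun e => v ∈ e).card
  have hTE : T ⊆ D.E := Finset.filter_subset _ _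
  have dc : ∀ (W : Finset α) (F : Finset (Finset α)),
      ∑ v ∈ W, (F.filter fun e => v ∈ e).card = ∑ e ∈ F, (W.filter fun v => v ∈ e).card :=
    fun W F => Finset.sum_card_bipartiteAbove_eq_sum_card_bipartiteBelow (fun v e => v ∈ e)
  have hblk : ∀ e ∈ D.E, (D.V.filter fun v => v ∈ e).card = 3 := by
    intro e he
    rw [← h3 e he]
    congr 1
    ext v
    simp only [Finset.mem_filter]
    exact ⟨fun h => h.2, fun h => ⟨(hD.2 e he).2 h, h⟩⟩
  have h1 : ∑ v ∈ D.V, D.rank v = 3 * D.E.card := by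
    have := dc D.V D.E
    rw [Finset.sum_congr rfl hblk, Finset.sum_const, smul_eq_mul] at this
    unfold PreDiagram.rank
    omega
  have h2 : ∑ v ∈ D.V, t v = 3 * T.card := by
    have := dc D.V T
    rw [Finset.sum_congr rfl (fun e he => hblk e (hTE he)), Finset.sum_const,
      smul_eq_mul] at this
    show ∑ v ∈ D.V, (T.filter fun e => v ∈ e).card = _
    omega
  have ht2 : ∀ v, D.rank v = 2 → t v = 2 := by
    intro v hv
    rw [← hv]
    show (T.filter fun e => v ∈ e).card = (D.E.filter fun e => v ∈ e).card
    congr 1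
    ext e
    simp only [T, Finset.mem_filter]
    exact ⟨fun h => ⟨h.1.1, h.2⟩, fun h => ⟨⟨h.1, v, h.2, hv⟩, h.2⟩⟩
  have htr : ∀ v, t v ≤ D.rank v := fun v =>
    Finset.card_le_card (Finset.filter_subset_filter _ hTE)
  have ht3 : ∀ v ∈ D.V, D.rank v = 3 → t v ≤ 1 := by
    intro v hv hv3
    by_contra hlt
    have : 1 < (T.filter fun e => v ∈ e).card := not_le.mp hlt
    obtain ⟨a, ha, b, hb, hab⟩ := Finset.one_lt_card.mp this
    simp only [T, Finset.mem_filter] at ha hb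
    exact hcon ⟨v, hv, hv3, a, ha.1.1, b, hb.1.1, hab, ha.2, hb.2, ha.1.2, hb.1.2⟩
  let W := D.V.filter fun v => D.rank v = 2
  have h4 : 2 * W.card ≤ T.card := by
    have h := dc W T
    have hl : ∑ v ∈ W, (T.filter fun e => v ∈ e).card = W.card * 2 := by
      rw [Finset.sum_congr rfl (fun v hv => ht2 v (Finset.mem_filter.mp hv).2),
        Finset.sum_const, smul_eq_mul]
    have hu : ∑ e ∈ T, (W.filter fun v => v ∈ e).card ≤ T.card * 1 := by
      rw [← smul_eq_mul]
      refine Finset.sum_le_card_nsmul _ _ _ fun e he => ?_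
      refine Finset.card_le_one.mpr fun a ha b hb => ?_
      simp only [W, Finset.mem_filter] at ha hb
      exact hno2 e (hTE he) a ha.2 b hb.2 ha.1.2 hb.1.2
    omega
  have h5 : ∑ v ∈ D.V, (14 + t v) ≤
      ∑ v ∈ D.V, (5 * D.rank v + 6 * (if D.rank v = 2 then 1 else 0)) := by
    refine Finset.sum_le_sum fun v hv => ?_
    have a := hr v hv
    have b := ht2 v
    have c := ht3 v hv
    have d := htr v
    split_ifs with h
    · have := b h
      omega
    · by_cases h' : D.rank v = 3
      · have := c h'
        omega
      · omega
  rw [Finset.sum_add_distrib, Finset.sum_add_distrib, ← Finset.mul_sum, ← Finset.mul_sum,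
    ← Finset.card_filter, h1, h2, Finset.sum_const, smul_eq_mul] at h5
  change _ ≤ _ + 6 * W.card at h5
  omega
end

section
/- Let 𝓗 be an infinite-dimensional complex Hilbert space, and let a, b, c, d, e, f be closed subspaces of 𝓗. If a ⊥ b, c ⊥ d, and e ⊥ f, then (a ∪ b) ∩ (c ∪ d) ∩ (e ∪ f) ≤ b ∪ ( a ∩ ( c ∪ ( ((a ∪ c) ∩ (b ∪ d)) ∩ ( ((a ∪ e) ∩ (b ∪ f)) ∪ ((c ∪ e) ∩ (d ∪ f)) ) ) ) ) (the orthoarguesian equation). -/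
open scoped InnerProductSpace

variable {H : Type*} [NormedAddCommGroup H] [InnerProductSpace ℂ H]

/-- Lattice join of (closed) subspaces of a Hilbert space: the closure of the
linear span of the union, i.e. the topological closure of `a + b`. -/
noncomputable def csup (a b : Submodule ℂ H) : Submodule ℂ H :=
  (a ⊔ b).topologicalClosure

/-- The Sasaki implication `a →₁ b := a′ ∪ (a ∩ b)`. -/
noncomputable def sasaki (a b : Submodule ℂ H) : Submodule ℂ H :=
  csup aᗮ (a ⊓ b)

theorem csup_decomp {H : Type*} [NormedAddCommGroup H]
    [InnerProductSpace ℂ H] [CompleteSpace H] (a b : Submodule ℂ H)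
    (ha : IsClosed (a : Set H)) (hb : IsClosed (b : Set H)) (hab : a ≤ bᗮ)
    {x : H} (hx : x ∈ csup a b) : ∃ y ∈ a, ∃ z ∈ b, x = y + z := by
  haveI : CompleteSpace a := ha.completeSpace_coe
  let T : H →L[ℂ] H := ContinuousLinearMap.id ℂ H - a.starProjection
  have hcl : IsClosed ((b.comap T.toLinearMap : Submodule ℂ H) : Set H) :=
    hb.preimage T.continuous
  have hle : csup a b ≤ b.comap T.toLinearMap := by
    refine Submodule.topologicalClosure_minimal _ (sup_le ?_ ?_) hcl
    · intro y hy
      have : a.starProjection y = y := Submodule.starProjection_eq_self_iff.2 hy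
      simp [T, this]
    · intro y hy
      have hy' : y ∈ aᗮ := by
        rw [Submodule.mem_orthogonal']
        intro u hu
        exact (Submodule.mem_orthogonal _ _).1 (hab hu) y hy
      have : a.starProjection y = 0 := by
        rw [Submodule.starProjection_apply_eq_zero_iff]; exact hy'
      simpa [T, this] using hy
  refine ⟨a.starProjection x, Submodule.starProjection_apply_mem _ _, T x, hle hx, ?_⟩
  simp [T]

theorem mem_csup_add {H : Type*} [NormedAddCommGroup H]
    [InnerProductSpace ℂ H] {a b : Submodule ℂ H} {x y z : H}
    (hy : y ∈ a) (hz : z ∈ b) (h : x = y + z) : x ∈ csup a b :=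
  h ▸ Submodule.le_topologicalClosure _ (Submodule.add_mem_sup hy hz)

/-- the orthoarguesian equation holds for closed subspaces of an
infinite-dimensional complex Hilbert space. -/
theorem orthoarguesian_equation {H : Type*} [NormedAddCommGroup H]
    [InnerProductSpace ℂ H] [CompleteSpace H]
    (hinf : ¬ FiniteDimensional ℂ H)
    (a b c d e f : Submodule ℂ H)
    (ha : IsClosed (a : Set H)) (hb : IsClosed (b : Set H))
    (hc : IsClosed (c : Set H)) (hd : IsClosed (d : Set H))
    (he : IsClosed (e : Set H)) (hf : IsClosed (f : Set H))
    (hab : a ≤ bᗮ) (hcd : c ≤ dᗮ) (hef : e ≤ fᗮ) :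
    csup a b ⊓ csup c d ⊓ csup e f ≤
      csup b (a ⊓ csup c ((csup a c ⊓ csup b d) ⊓
        csup (csup a e ⊓ csup b f) (csup c e ⊓ csup d f))) := by
  rintro x ⟨⟨h1, h2⟩, h3⟩
  obtain ⟨p, hp, q, hq, e1⟩ := csup_decomp a b ha hb hab h1
  obtain ⟨r, hr, s, hs, e2⟩ := csup_decomp c d hc hd hcd h2
  obtain ⟨t, ht, u, hu, e3⟩ := csup_decomp e f he hf hef h3
  have k1 : p + q = r + s := e1.symm.trans e2
  have k2 : p + q = t + u := e1.symm.trans e3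
  have k3 : r + s = t + u := e2.symm.trans e3
  have g : ∀ v w v' w' : H, v + w = v' + w' → v - v' = -w + w' := by
    intro v w v' w' h
    rw [sub_eq_iff_eq_add, eq_comm]
    calc -w + w' + v' = -w + (v' + w') := by abel
      _ = v := by rw [← h]; abel
  refine mem_csup_add hq ⟨hp, mem_csup_add hr (z := p - r) ⟨⟨?_, ?_⟩, ?_⟩ (by abel)⟩
    (by rw [e1, add_comm])
  · exact mem_csup_add hp (neg_mem hr) (by abel)
  · exact mem_csup_add (neg_mem hq) hs (g _ _ _ _ k1)
  · refine mem_csup_add (y := p - t) (z := t - r) ⟨?_, ?_⟩ ⟨?_, ?_⟩ (by abel)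
    · exact mem_csup_add hp (neg_mem ht) (by abel)
    · exact mem_csup_add (neg_mem hq) hu (g _ _ _ _ k2)
    · exact mem_csup_add (neg_mem hr) ht (by abel)
    · exact mem_csup_add hs (neg_mem hu) ((g _ _ _ _ k3.symm).trans (add_comm _ _))
end

section
/- Let 𝓗 be an infinite-dimensional complex Hilbert space, and let a, b, c be closed subspaces of 𝓗. Then (a →₁ b) ∩ (b →₁ c) ∩ (c →₁ a) ≤ a →₁ c (Godowski's 3-variable equation). -/
open scoped InnerProductSpace

variable {H : Type*} [NormedAddCommGroup H] [InnerProductSpace ℂ H]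

theorem mem_sasaki_iff_aux {H : Type*} [NormedAddCommGroup H] [InnerProductSpace ℂ H]
    (a b : Submodule ℂ H) [a.HasOrthogonalProjection] (hb : IsClosed (b : Set H)) (x : H) :
    x ∈ sasaki a b ↔ a.starProjection x ∈ b := by
  constructor
  · intro hx
    have hcl : IsClosed ((b.comap (a.starProjection : H →ₗ[ℂ] H) : Submodule ℂ H) : Set H) :=
      hb.preimage a.starProjection.continuous
    have hle : aᗮ ⊔ (a ⊓ b) ≤ b.comap (a.starProjection : H →ₗ[ℂ] H) := by
      refine sup_le ?_ ?_
      · intro y hy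
        have : a.starProjection y = 0 := a.starProjection_apply_eq_zero_iff.2 hy
        simp [this]
      · rintro y ⟨hy, hyb⟩
        have : a.starProjection y = y := Submodule.starProjection_eq_self_iff.2 hy
        simpa [this] using hyb
    exact Submodule.topologicalClosure_minimal _ hle hcl hx
  · intro hx
    apply Submodule.le_topologicalClosure
    have h1 : x - a.starProjection x ∈ aᗮ := a.sub_starProjection_mem_orthogonal x
    have h2 : a.starProjection x ∈ a ⊓ b := ⟨a.starProjection_apply_mem x, hx⟩
    have := Submodule.add_mem_sup h1 h2
    simpa using this

theorem norm_aux {H : Type*} [NormedAddCommGroup H] [InnerProductSpace ℂ H]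
    (a b : Submodule ℂ H) [a.HasOrthogonalProjection] [b.HasOrthogonalProjection] (x : H)
    (h : a.starProjection x ∈ b) :
    ‖b.starProjection x‖ * ‖b.starProjection x‖ =
      ‖b.starProjection x - a.starProjection x‖ * ‖b.starProjection x - a.starProjection x‖
        + ‖a.starProjection x‖ * ‖a.starProjection x‖ := by
  have h1 : inner ℂ (x - a.starProjection x) (a.starProjection x) = 0 :=
    Submodule.inner_left_of_mem_orthogonal (a.starProjection_apply_mem x)
      (a.sub_starProjection_mem_orthogonal x)
  have h2 : inner ℂ (x - b.starProjection x) (a.starProjection x) = 0 :=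
    Submodule.inner_left_of_mem_orthogonal h (b.sub_starProjection_mem_orthogonal x)
  have h3 : inner ℂ (b.starProjection x - a.starProjection x) (a.starProjection x) = 0 := by
    rw [inner_sub_left] at *
    rw [← sub_eq_zero.1 h1, ← sub_eq_zero.1 h2, sub_self]
  have := norm_add_sq_eq_norm_sq_add_norm_sq_of_inner_eq_zero _ _ h3
  simpa using this

/-- Godowski's 3-variable equation holds for closed subspaces of
an infinite-dimensional complex Hilbert space. -/
theorem godowski_three_variable {H : Type*} [NormedAddCommGroup H]
    [InnerProductSpace ℂ H] [CompleteSpace H]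
    (hinf : ¬ FiniteDimensional ℂ H)
    (a b c : Submodule ℂ H)
    (ha : IsClosed (a : Set H)) (hb : IsClosed (b : Set H))
    (hc : IsClosed (c : Set H)) :
    sasaki a b ⊓ sasaki b c ⊓ sasaki c a ≤ sasaki a c := by
  haveI := ha.completeSpace_coe
  haveI := hb.completeSpace_coe
  haveI := hc.completeSpace_coe
  rintro x ⟨⟨h1, h2⟩, h3⟩
  have h1 := (mem_sasaki_iff_aux a b hb x).1 h1
  have h2 := (mem_sasaki_iff_aux b c hc x).1 h2
  have h3 := (mem_sasaki_iff_aux c a ha x).1 h3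
  refine (mem_sasaki_iff_aux a c hc x).2 ?_
  have n1 := norm_aux a b x h1
  have n2 := norm_aux b c x h2
  have n3 := norm_aux c a x h3
  have z : ‖a.starProjection x - c.starProjection x‖ = 0 := by
    refine mul_self_eq_zero.1 (le_antisymm ?_ (mul_self_nonneg _))
    linarith [mul_self_nonneg ‖b.starProjection x - a.starProjection x‖,
      mul_self_nonneg ‖c.starProjection x - b.starProjection x‖,
      mul_self_nonneg ‖a.starProjection x - c.starProjection x‖]
  rw [sub_eq_zero.1 (norm_eq_zero.1 z)]
  exact c.starProjection_apply_mem x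
end

section
/- Let 𝓗 be an infinite-dimensional complex Hilbert space, and let a, b, c, d be closed subspaces of 𝓗. Then (a →₁ b) ∩ (b →₁ c) ∩ (c →₁ d) ∩ (d →₁ a) ≤ a →₁ d (Godowski's 4-variable strong state equation). -/
open scoped InnerProductSpace

variable {H : Type*} [NormedAddCommGroup H] [InnerProductSpace ℂ H]

theorem sasaki_pyth_aux {H : Type*} [NormedAddCommGroup H]
    [InnerProductSpace ℂ H] (b : Submodule ℂ H) [b.HasOrthogonalProjection]
    (x y : H) (hy : y ∈ b) :
    ‖x - y‖ * ‖x - y‖ = ‖x - b.starProjection x‖ * ‖x - b.starProjection x‖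
      + ‖b.starProjection x - y‖ * ‖b.starProjection x - y‖ := by
  rw [← norm_add_sq_eq_norm_sq_add_norm_sq_of_inner_eq_zero (𝕜 := ℂ)]
  · simp
  · exact Submodule.inner_left_of_mem_orthogonal
      (b.sub_mem (b.starProjection_apply_mem x) hy) (b.sub_starProjection_mem_orthogonal x)

/-- Godowski's 4-variable strong state equation holds for closed
subspaces of an infinite-dimensional complex Hilbert space. -/
theorem godowski_four_variable {H : Type*} [NormedAddCommGroup H]
    [InnerProductSpace ℂ H] [CompleteSpace H]
    (hinf : ¬ FiniteDimensional ℂ H)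
    (a b c d : Submodule ℂ H)
    (ha : IsClosed (a : Set H)) (hb : IsClosed (b : Set H))
    (hc : IsClosed (c : Set H)) (hd : IsClosed (d : Set H)) :
    sasaki a b ⊓ sasaki b c ⊓ sasaki c d ⊓ sasaki d a ≤ sasaki a d := by
  have := ha.completeSpace_coe
  have := hb.completeSpace_coe
  have := hc.completeSpace_coe
  have := hd.completeSpace_coe
  rintro x ⟨⟨⟨h1, h2⟩, h3⟩, h4⟩
  rw [SetLike.mem_coe, mem_sasaki_iff_aux _ _ ‹_›] at h1 h2 h3 h4
  rw [mem_sasaki_iff_aux _ _ ‹_›]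
  have e1 := sasaki_pyth_aux b x _ h1
  have e2 := sasaki_pyth_aux c x _ h2
  have e3 := sasaki_pyth_aux d x _ h3
  have e4 := sasaki_pyth_aux a x _ h4
  have h0 : ‖a.starProjection x - d.starProjection x‖ = 0 := by
    apply mul_self_eq_zero.1
    apply le_antisymm _ (mul_self_nonneg _)
    linarith [mul_self_nonneg ‖b.starProjection x - a.starProjection x‖,
      mul_self_nonneg ‖c.starProjection x - b.starProjection x‖,
      mul_self_nonneg ‖d.starProjection x - c.starProjection x‖]
  rw [sub_eq_zero.1 (norm_eq_zero.1 h0)]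
  exact d.starProjection_apply_mem x
end

section
/- Let 𝓗 be an infinite-dimensional complex Hilbert space, and let a₁, a₂, a₃, a₄ be closed subspaces of 𝓗. Then (a₁ →₁ a₃) ∩ (a₁ ≡⁽⁴⁾ a₂) ≤ a₂ →₁ a₃ (the 4OA law). -/
open scoped InnerProductSpace

variable {H : Type*} [NormedAddCommGroup H] [InnerProductSpace ℂ H]

/-- The quantum biconditional `a₁ ≡⁽³⁾ a₂` (relative to `a₃`). -/
noncomputable def equiv3 (a₁ a₂ a₃ : Submodule ℂ H) : Submodule ℂ H :=
  csup (sasaki a₁ a₃ ⊓ sasaki a₂ a₃) (sasaki a₁ᗮ a₃ ⊓ sasaki a₂ᗮ a₃)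

/-- The quantum biconditional `a₁ ≡⁽⁴⁾ a₂` (relative to `a₃` and `a₄`). -/
noncomputable def equiv4 (a₁ a₂ a₃ a₄ : Submodule ℂ H) : Submodule ℂ H :=
  csup (equiv3 a₁ a₂ a₃) (equiv3 a₁ a₄ a₃ ⊓ equiv3 a₂ a₄ a₃)

lemma mem_csup_orth {H : Type*} [NormedAddCommGroup H] [InnerProductSpace ℂ H]
    {u v : Submodule ℂ H} {x : H} (h1 : x ∈ uᗮ) (h2 : x ∈ vᗮ) : x ∈ (csup u v)ᗮ := by
  unfold csup
  rw [Submodule.orthogonal_closure, ← Submodule.inf_orthogonal]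
  exact ⟨h1, h2⟩

lemma proj_mem {H : Type*} [NormedAddCommGroup H] [InnerProductSpace ℂ H]
    (a c : Submodule ℂ H) [a.HasOrthogonalProjection] {x : H} (hx : x ∈ cᗮ) :
    a.starProjection x ∈ (sasaki a c)ᗮ ∧ x - a.starProjection x ∈ (sasaki aᗮ c)ᗮ := by
  have hp : a.starProjection x ∈ a := Submodule.starProjection_apply_mem a x
  have hq : x - a.starProjection x ∈ aᗮ := Submodule.sub_starProjection_mem_orthogonal x
  refine ⟨mem_csup_orth (Submodule.le_orthogonal_orthogonal a hp) ?_,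
    mem_csup_orth (Submodule.le_orthogonal_orthogonal _ hq) ?_⟩
  · have h1 : x ∈ (a ⊓ c)ᗮ := Submodule.orthogonal_le inf_le_right hx
    have h2 : x - a.starProjection x ∈ (a ⊓ c)ᗮ := Submodule.orthogonal_le inf_le_left hq
    simpa using sub_mem h1 h2
  · have h1 : x ∈ (aᗮ ⊓ c)ᗮ := Submodule.orthogonal_le inf_le_right hx
    have h2 : a.starProjection x ∈ (aᗮ ⊓ c)ᗮ :=
      Submodule.orthogonal_le inf_le_left (Submodule.le_orthogonal_orthogonal a hp)
    exact sub_mem h1 h2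

lemma diff_mem {H : Type*} [NormedAddCommGroup H] [InnerProductSpace ℂ H]
    (a b c : Submodule ℂ H) [a.HasOrthogonalProjection] [b.HasOrthogonalProjection]
    {x : H} (hx : x ∈ cᗮ) :
    a.starProjection x - b.starProjection x ∈ (equiv3 a b c)ᗮ := by
  obtain ⟨ha, ha'⟩ := proj_mem a c hx
  obtain ⟨hb, hb'⟩ := proj_mem b c hx
  refine mem_csup_orth (sub_mem (Submodule.orthogonal_le inf_le_left ha)
    (Submodule.orthogonal_le inf_le_right hb)) ?_
  have := sub_mem (Submodule.orthogonal_le (inf_le_right (a := sasaki aᗮ c)) hb')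
    (Submodule.orthogonal_le (inf_le_left (b := sasaki bᗮ c)) ha')
  simpa using this

/-- the 4OA law holds for closed subspaces of an
infinite-dimensional complex Hilbert space. -/
theorem fourOA_law {H : Type*} [NormedAddCommGroup H]
    [InnerProductSpace ℂ H] [CompleteSpace H]
    (hinf : ¬ FiniteDimensional ℂ H)
    (a₁ a₂ a₃ a₄ : Submodule ℂ H)
    (h₁ : IsClosed (a₁ : Set H)) (h₂ : IsClosed (a₂ : Set H))
    (h₃ : IsClosed (a₃ : Set H)) (h₄ : IsClosed (a₄ : Set H)) :
    sasaki a₁ a₃ ⊓ equiv4 a₁ a₂ a₃ a₄ ≤ sasaki a₂ a₃ := by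
  have : CompleteSpace a₁ := h₁.completeSpace_coe
  have : CompleteSpace a₂ := h₂.completeSpace_coe
  have : CompleteSpace a₃ := h₃.completeSpace_coe
  have : CompleteSpace a₄ := h₄.completeSpace_coe
  rintro y ⟨hy1, hy4⟩
  have key : a₂.starProjection y ∈ a₃ := by
    rw [← Submodule.orthogonal_orthogonal a₃, Submodule.mem_orthogonal]
    intro x hx
    have e1 := (Submodule.mem_orthogonal _ _).1 (proj_mem a₁ a₃ hx).1 y hy1
    have hd : a₁.starProjection x - a₂.starProjection x ∈ (equiv4 a₁ a₂ a₃ a₄)ᗮ := by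
      refine mem_csup_orth (diff_mem a₁ a₂ a₃ hx) ?_
      have := sub_mem
        (Submodule.orthogonal_le (inf_le_left (b := equiv3 a₂ a₄ a₃)) (diff_mem a₁ a₄ a₃ hx))
        (Submodule.orthogonal_le (inf_le_right (a := equiv3 a₁ a₄ a₃)) (diff_mem a₂ a₄ a₃ hx))
      simpa using this
    have e2 := (Submodule.mem_orthogonal _ _).1 hd y hy4
    rw [inner_sub_right, e1, zero_sub, neg_eq_zero] at e2
    rw [← Submodule.inner_starProjection_left_eq_right, inner_eq_zero_symm]
    exact e2
  refine Submodule.le_topologicalClosure _ ?_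
  have := Submodule.add_mem_sup (Submodule.sub_starProjection_mem_orthogonal (K := a₂) y)
    (show a₂.starProjection y ∈ a₂ ⊓ a₃ from ⟨Submodule.starProjection_apply_mem a₂ y, key⟩)
  simpa using this
end

section
/- Let 𝓗 be an infinite-dimensional complex Hilbert space and let n ≥ 4 be a natural number. For all closed subspaces a₁, a₂, …, aₙ of 𝓗, (a₁ →₁ a₃) ∩ (a₁ ≡⁽ⁿ⁾ a₂) ≤ a₂ →₁ a₃ (the nOA law). -/
open scoped InnerProductSpace

variable {H : Type*} [NormedAddCommGroup H] [InnerProductSpace ℂ H]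

/-- `equivN a n x y` is the quantum biconditional `x ≡⁽ⁿ⁾ y` relative to the
family `a` (it depends on `a 3, …, a n`), defined for `n ≥ 3` by
`x ≡⁽³⁾ y := equiv3 x y (a 3)` and, for `n ≥ 4`,
`x ≡⁽ⁿ⁾ y := (x ≡⁽ⁿ⁻¹⁾ y) ∪ ((x ≡⁽ⁿ⁻¹⁾ a n) ∩ (y ≡⁽ⁿ⁻¹⁾ a n))`.
(Values for `n ≤ 3` are set to the base case `≡⁽³⁾`.) -/
noncomputable def equivN (a : ℕ → Submodule ℂ H) :
    ℕ → Submodule ℂ H → Submodule ℂ H → Submodule ℂ H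
  | 0, x, y => equiv3 x y (a 3)
  | 1, x, y => equiv3 x y (a 3)
  | 2, x, y => equiv3 x y (a 3)
  | 3, x, y => equiv3 x y (a 3)
  | (n + 4), x, y =>
      csup (equivN a (n + 3) x y)
        (equivN a (n + 3) x (a (n + 4)) ⊓ equivN a (n + 3) y (a (n + 4)))

theorem csup_le_of {a b c : Submodule ℂ H} (hc : IsClosed (c : Set H)) (ha : a ≤ c) (hb : b ≤ c) :
    csup a b ≤ c :=
  Submodule.topologicalClosure_minimal _ (sup_le ha hb) hc

/-- The closed subspace of vectors `z` with `T z ∈ c`. -/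
def pre (c : Submodule ℂ H) (T : H →L[ℂ] H) : Submodule ℂ H := c.comap (T : H →ₗ[ℂ] H)

theorem mem_pre {c : Submodule ℂ H} {T : H →L[ℂ] H} {z : H} : z ∈ pre c T ↔ T z ∈ c := Iff.rfl

theorem pre_closed {c : Submodule ℂ H} (hc : IsClosed (c : Set H)) (T : H →L[ℂ] H) :
    IsClosed (pre c T : Set H) := hc.preimage T.continuous

theorem sasaki_le_pre {c x : Submodule ℂ H} (hc : IsClosed (c : Set H))
    [x.HasOrthogonalProjection] : sasaki x c ≤ pre c x.starProjection := by
  refine csup_le_of (pre_closed hc _) ?_ ?_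
  · intro z hz
    rw [mem_pre, (Submodule.starProjection_apply_eq_zero_iff x).2 hz]
    exact c.zero_mem
  · rintro z ⟨hz, hz'⟩
    rw [mem_pre, Submodule.starProjection_eq_self_iff.2 hz]
    exact hz'

theorem pre_le_sasaki {c x : Submodule ℂ H}
    [x.HasOrthogonalProjection] : pre c x.starProjection ≤ sasaki x c := by
  intro z hz
  apply Submodule.le_topologicalClosure
  have h : z = (z - x.starProjection z) + x.starProjection z := by abel
  rw [h]
  exact Submodule.add_mem_sup (Submodule.sub_starProjection_mem_orthogonal z)
    ⟨Submodule.starProjection_apply_mem x z, hz⟩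

theorem equiv3_le_pre {c x y : Submodule ℂ H} (hc : IsClosed (c : Set H))
    [x.HasOrthogonalProjection] [y.HasOrthogonalProjection] :
    equiv3 x y c ≤ pre c (x.starProjection - y.starProjection) := by
  refine csup_le_of (pre_closed hc _) ?_ ?_
  · rintro z ⟨hx, hy⟩
    exact c.sub_mem (sasaki_le_pre hc hx) (sasaki_le_pre hc hy)
  · rintro z ⟨hx, hy⟩
    have h := c.sub_mem (mem_pre.1 (sasaki_le_pre hc hy)) (mem_pre.1 (sasaki_le_pre hc hx))
    rw [Submodule.starProjection_orthogonal_val, Submodule.starProjection_orthogonal_val] at h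
    rw [mem_pre]
    have e : (x.starProjection - y.starProjection) z
      = (z - y.starProjection z) - (z - x.starProjection z) := by
      rw [ContinuousLinearMap.sub_apply]; abel
    rw [e]; exact h

theorem equivN_le_pre (a : ℕ → Submodule ℂ H) (hc : IsClosed (a 3 : Set H)) (n : ℕ)
    (ha : ∀ i, 1 ≤ i → i ≤ n + 3 → (a i).HasOrthogonalProjection) :
    ∀ (x y : Submodule ℂ H) [x.HasOrthogonalProjection] [y.HasOrthogonalProjection],
    equivN a (n + 3) x y ≤ pre (a 3) (x.starProjection - y.starProjection) := by
  induction n with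
  | zero => intro x y _ _; exact equiv3_le_pre hc
  | succ n ih =>
    intro x y _ _
    have ih := ih (fun i h h' => ha i h (by omega))
    haveI := ha (n + 4) (by omega) (by omega)
    refine csup_le_of (pre_closed hc _) (ih x y) ?_
    rintro z ⟨hx, hy⟩
    have h := (a 3).sub_mem (mem_pre.1 (ih x _ hx)) (mem_pre.1 (ih y _ hy))
    rw [mem_pre]
    simpa using h

/-- the nOA law (`n ≥ 4`) holds for closed subspaces
`a 1, …, a n` of an infinite-dimensional complex Hilbert space. -/
theorem nOA_law {H : Type*} [NormedAddCommGroup H]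
    [InnerProductSpace ℂ H] [CompleteSpace H]
    (hinf : ¬ FiniteDimensional ℂ H)
    (n : ℕ) (hn : 4 ≤ n)
    (a : ℕ → Submodule ℂ H)
    (hclosed : ∀ i, 1 ≤ i → i ≤ n → IsClosed ((a i : Set H))) :
    sasaki (a 1) (a 3) ⊓ equivN a n (a 1) (a 2) ≤ sasaki (a 2) (a 3) := by
  have hP : ∀ i, 1 ≤ i → i ≤ n → (a i).HasOrthogonalProjection := by
    intro i h h'
    haveI : CompleteSpace (a i) := (hclosed i h h').completeSpace_coe
    infer_instance
  obtain ⟨m, rfl⟩ : ∃ m, n = m + 3 := ⟨n - 3, by omega⟩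
  have hc := hclosed 3 (by omega) (by omega)
  haveI := hP 1 (by omega) (by omega)
  haveI := hP 2 (by omega) (by omega)
  rintro z ⟨h1, h2⟩
  apply pre_le_sasaki
  have h := (a 3).sub_mem (mem_pre.1 (sasaki_le_pre hc h1))
    (mem_pre.1 (equivN_le_pre a hc m hP (a 1) (a 2) h2))
  rw [mem_pre]
  simpa using h
end
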